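/- Let m ≥ 1, let κ = (k₁, …, k_m) ∈ ℝ^m, let A be an m×m real positive definite matrix, and let B be an m×m real upper triangular matrix with nonzero diagonal entries. Then q_κ(B^{−ᵀ} A B^{−1}) = q_κ(Bᵀ B)^{−1} · q_κ(A), where B^{−ᵀ} denotes the transpose of B^{−1}. -/

import Mathlib

open MeasureTheory Matrix Real

/-- Lebesgue (product) measure on `n × m` real matrices, via the identification with `ℝ^{nm}`. -/
noncomputable instance matMeasureSpace (n m : ℕ) : MeasureSpace (Matrix (Fin n) (Fin m) ℝ) :=
  (inferInstance : MeasureSpace (Fin n → Fin m → ℝ))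

/-- Determinant of the leading principal `(i+1) × (i+1)` submatrix. -/
noncomputable def princMinor {m : ℕ} (A : Matrix (Fin m) (Fin m) ℝ) (i : Fin m) : ℝ :=
  (A.submatrix (fun j : Fin (i.1 + 1) => Fin.castLE i.isLt j)
    (fun j : Fin (i.1 + 1) => Fin.castLE i.isLt j)).det

/-- The highest weight vector (generalized power)
`q_κ(A) = det(A)^{k_m} ∏_{i=1}^{m-1} det(A_i)^{k_i - k_{i+1}}`. -/
noncomputable def hwv {m : ℕ} (κ : Fin m → ℝ) (A : Matrix (Fin m) (Fin m) ℝ) : ℝ :=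
  ∏ i : Fin m, princMinor A i ^ (if h : i.1 + 1 < m then κ i - κ ⟨i.1 + 1, h⟩ else κ i)

/-- The real multivariate gamma function `Γ_m(a) = π^{m(m-1)/4} ∏ Γ(a - (i-1)/2)`. -/
noncomputable def mvGamma (m : ℕ) (a : ℝ) : ℝ :=
  Real.pi ^ (((m * (m - 1) : ℕ) : ℝ) / 4) * ∏ i : Fin m, Real.Gamma (a - (i : ℝ) / 2)

/-- The generalized gamma function of weight `τ`:
`Γ_m(a, τ) = π^{m(m-1)/4} ∏ Γ(a + t_i - (i-1)/2)`. -/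
noncomputable def mvGammaI (m : ℕ) (a : ℝ) (τ : Fin m → ℝ) : ℝ :=
  Real.pi ^ (((m * (m - 1) : ℕ) : ℝ) / 4) * ∏ i : Fin m, Real.Gamma (a + τ i - (i : ℝ) / 2)

/-- The generalized gamma function of weight `-τ`:
`Γ_m(a, -τ) = π^{m(m-1)/4} ∏ Γ(a - t_i - (m-i)/2)`. -/
noncomputable def mvGammaII (m : ℕ) (a : ℝ) (τ : Fin m → ℝ) : ℝ :=
  Real.pi ^ (((m * (m - 1) : ℕ) : ℝ) / 4) *
    ∏ i : Fin m, Real.Gamma (a - τ i - ((m : ℝ) - 1 - (i : ℝ)) / 2)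

/-- Lebesgue measure on `m × m` real symmetric matrices: the pushforward of the product
Lebesgue measure in the coordinates `(x_{ij})_{i ≤ j}` under the obvious parametrization. -/
noncomputable def symmVol (m : ℕ) : Measure (Matrix (Fin m) (Fin m) ℝ) :=
  Measure.map (fun f : {p : Fin m × Fin m // p.1 ≤ p.2} → ℝ =>
    Matrix.of fun i j => if h : i ≤ j then f ⟨(i, j), h⟩ else f ⟨(j, i), le_of_not_ge h⟩) volume

/-- The eigenvalues of `XᵀX`, arranged in decreasing order. -/
noncomputable def sortedEigs {n m : ℕ} (X : Matrix (Fin n) (Fin m) ℝ) : Fin m → ℝ :=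
  fun i =>
    ((Matrix.isHermitian_conjTranspose_mul_self X).eigenvalues ∘
      Tuple.sort (Matrix.isHermitian_conjTranspose_mul_self X).eigenvalues) (Fin.rev i)

/-- The singular values of an `n × m` real matrix, in decreasing order. -/
noncomputable def svalues {n m : ℕ} (X : Matrix (Fin n) (Fin m) ℝ) : Fin m → ℝ :=
  fun i => Real.sqrt (sortedEigs X i)

/-- Right multiplication by an upper triangular matrix commutes with truncation to the leading
columns. -/
theorem submatrix_mul_of_blockTriangular {m n : ℕ} {ι κ : Type*} (h : n ≤ m)
    (A : Matrix ι (Fin m) ℝ) {C : Matrix (Fin m) (Fin m) ℝ} (hC : C.BlockTriangular id)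
    (g : κ → ι) :
    (A * C).submatrix g (Fin.castLE h) =
      A.submatrix g (Fin.castLE h) * C.submatrix (Fin.castLE h) (Fin.castLE h) := by
  ext a j
  simp only [submatrix_apply, mul_apply]
  symm
  refine Fintype.sum_of_injective (Fin.castLE h) (Fin.castLE_injective h) _ _ ?_ fun _ => rfl
  intro k hk
  have hjk : Fin.castLE h j < k := by
    by_contra hle
    have hkj : k.1 ≤ j.1 := not_lt.mp hle
    exact hk ⟨⟨k.1, hkj.trans_lt j.isLt⟩, rfl⟩
  have hzero : C k (Fin.castLE h j) = 0 := hC hjk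
  rw [hzero, mul_zero]

theorem princMinor_transpose_mul_mul {m : ℕ} (A : Matrix (Fin m) (Fin m) ℝ)
    {C : Matrix (Fin m) (Fin m) ℝ} (hC : C.BlockTriangular id) (i : Fin m) :
    princMinor (Cᵀ * A * C) i = princMinor C i ^ 2 * princMinor A i := by
  have hT : (Cᵀ * A).submatrix (Fin.castLE i.isLt) (Fin.castLE i.isLt) =
      (C.submatrix (Fin.castLE i.isLt) (Fin.castLE i.isLt))ᵀ *
        A.submatrix (Fin.castLE i.isLt) (Fin.castLE i.isLt) := by
    have := congrArg transpose
      (submatrix_mul_of_blockTriangular i.isLt Aᵀ hC (Fin.castLE i.isLt))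
    simpa [transpose_submatrix, transpose_mul] using this
  unfold princMinor
  rw [submatrix_mul_of_blockTriangular i.isLt _ hC, hT, det_mul, det_mul, det_transpose]
  ring

theorem princMinor_ne_zero_of_blockTriangular {m : ℕ} {C : Matrix (Fin m) (Fin m) ℝ}
    (hC : C.BlockTriangular id) (hd : ∀ i, C i i ≠ 0) (i : Fin m) : princMinor C i ≠ 0 := by
  unfold princMinor
  rw [det_of_isUpperTriangular]
  · exact Finset.prod_ne_zero_iff.mpr fun j _ => hd _
  · intro a b hab
    exact hC (show Fin.castLE i.isLt b < Fin.castLE i.isLt a from hab)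

theorem princMinor_pos {m : ℕ} {A : Matrix (Fin m) (Fin m) ℝ} (hA : A.PosDef) (i : Fin m) :
    0 < princMinor A i :=
  (hA.submatrix (Fin.castLE_injective i.isLt)).det_pos

theorem princMinor_one {m : ℕ} (i : Fin m) :
    princMinor (1 : Matrix (Fin m) (Fin m) ℝ) i = 1 := by
  unfold princMinor
  rw [submatrix_one _ (Fin.castLE_injective i.isLt), det_one]

/-- for `A` positive definite and `B` upper triangular with nonzero
diagonal entries, `q_κ(B^{-ᵀ} A B^{-1}) = q_κ(Bᵀ B)⁻¹ · q_κ(A)`. -/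
theorem stmt_7 (m : ℕ) (hm : 1 ≤ m) (κ : Fin m → ℝ)
    (A : Matrix (Fin m) (Fin m) ℝ) (hA : A.PosDef)
    (B : Matrix (Fin m) (Fin m) ℝ) (hB : B.BlockTriangular id)
    (hBd : ∀ i, B i i ≠ 0) :
    hwv κ ((B⁻¹)ᵀ * A * B⁻¹) = (hwv κ (Bᵀ * B))⁻¹ * hwv κ A := by
  have hdet : IsUnit B.det := by
    rw [det_of_isUpperTriangular hB]
    exact (Finset.prod_ne_zero_iff.mpr fun j _ => hBd j).isUnit
  have hconj : Bᵀ * ((B⁻¹)ᵀ * A * B⁻¹) * B = A := by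
    have h₁ : Bᵀ * (B⁻¹)ᵀ = 1 := by
      rw [← transpose_mul, nonsing_inv_mul _ hdet, transpose_one]
    calc Bᵀ * ((B⁻¹)ᵀ * A * B⁻¹) * B = (Bᵀ * (B⁻¹)ᵀ) * A * (B⁻¹ * B) := by
          simp only [Matrix.mul_assoc]
      _ = A := by rw [h₁, nonsing_inv_mul _ hdet, Matrix.one_mul, Matrix.mul_one]
  have hgram (i : Fin m) : princMinor (Bᵀ * B) i = princMinor B i ^ 2 := by
    simpa [princMinor_one] using princMinor_transpose_mul_mul 1 hB i
  unfold hwv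
  rw [← Finset.prod_inv_distrib, ← Finset.prod_mul_distrib]
  refine Finset.prod_congr rfl fun i _ => ?_
  have hsq : 0 < princMinor B i ^ 2 :=
    sq_pos_of_ne_zero (princMinor_ne_zero_of_blockTriangular hB hBd i)
  have hmul := princMinor_transpose_mul_mul ((B⁻¹)ᵀ * A * B⁻¹) hB i
  rw [hconj] at hmul
  have hpos : 0 < princMinor ((B⁻¹)ᵀ * A * B⁻¹) i :=
    pos_of_mul_pos_right (hmul ▸ princMinor_pos hA i) hsq.le
  rw [hgram, hmul, Real.mul_rpow hsq.le hpos.le,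
    inv_mul_cancel_left₀ (Real.rpow_pos_of_pos hsq _).ne']
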